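/- Let V be a real M×N matrix of full column rank N and G(w) := Vᵀ·diag(w)·V. At any w ∈ ℝ^M at which G(w) is positive definite, the function E(w) := −(1/N)·log(det G(w)) + Σᵢ wᵢ is twice differentiable and its second partial derivatives are ∂²E/∂wᵢ∂wⱼ (w) = (1/N)·((V·G(w)⁻¹·Vᵀ)ᵢⱼ)², i.e., the (i,j) entry of the Hessian of E at w equals the square of the (i,j) entry of V·G(w)⁻¹·Vᵀ divided by N. -/

import Mathlib

open Matrix

section WeightedGram

variable {m n : Type*} [Fintype m] [DecidableEq m]

/-- The Gram matrix of the columns of `V` with respect to the weights `w`. -/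
def weightedGram (V : Matrix m n ℝ) (w : m → ℝ) : Matrix n n ℝ :=
  Vᵀ * diagonal w * V

lemma weightedGram_add (V : Matrix m n ℝ) (v w : m → ℝ) :
    weightedGram V (v + w) = weightedGram V v + weightedGram V w := by
  simp only [weightedGram, ← Matrix.mul_add, ← Matrix.add_mul, diagonal_add, Pi.add_def]

lemma weightedGram_smul_single (V : Matrix m n ℝ) (i : m) (t : ℝ) :
    weightedGram V (t • Pi.single i 1) =
      replicateCol Unit (t • V i) * replicateRow Unit (V i) := by
  ext a b
  simp [weightedGram, Matrix.mul_apply, Matrix.diagonal_apply, Pi.single_apply, mul_comm]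

lemma differentiable_weightedGram_apply (V : Matrix m n ℝ) (a b : n) :
    Differentiable ℝ fun w => weightedGram V w a b := by
  simp only [weightedGram, Matrix.mul_apply, Matrix.diagonal_apply, mul_ite, mul_zero,
    Finset.sum_ite_eq', Finset.mem_univ, if_true]
  fun_prop

variable [Fintype n] [DecidableEq n]

/-- The reproducing kernel matrix of the weighted least-squares problem. -/
noncomputable def weightedKernel (V : Matrix m n ℝ) (w : m → ℝ) : Matrix m m ℝ :=
  V * (weightedGram V w)⁻¹ * Vᵀ

lemma weightedKernel_apply (V : Matrix m n ℝ) (w : m → ℝ) (i j : m) :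
    weightedKernel V w i j = V i ⬝ᵥ (weightedGram V w)⁻¹ *ᵥ V j := by
  rw [dotProduct_mulVec]
  rfl

lemma weightedKernel_isSymm (V : Matrix m n ℝ) (w : m → ℝ) :
    (weightedKernel V w).IsSymm := by
  simp [Matrix.IsSymm, weightedKernel, weightedGram, transpose_nonsing_inv, Matrix.mul_assoc]

lemma det_weightedGram_add_smul_single {V : Matrix m n ℝ} {w : m → ℝ}
    (hw : (weightedGram V w).det ≠ 0) (i : m) (t : ℝ) :
    (weightedGram V (w + t • Pi.single i 1)).det =
      (weightedGram V w).det * (1 + t * weightedKernel V w i i) := by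
  rw [weightedGram_add, weightedGram_smul_single,
    det_add_replicateCol_mul_replicateRow hw.isUnit, det_unique (n := Unit), weightedKernel_apply,
    Matrix.mul_assoc, ← replicateCol_mulVec, Matrix.add_apply, one_apply_eq,
    replicateRow_mul_replicateCol_apply, mulVec_smul, dotProduct_smul, smul_eq_mul]

lemma weightedKernel_add_smul_single {V : Matrix m n ℝ} {w : m → ℝ}
    (hw : (weightedGram V w).det ≠ 0) {i : m} {t : ℝ}
    (ht : (weightedGram V (w + t • Pi.single i 1)).det ≠ 0) (j k : m) :
    weightedKernel V (w + t • Pi.single i 1) j k =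
      weightedKernel V w j k -
        t * (weightedKernel V (w + t • Pi.single i 1) j i * weightedKernel V w i k) := by
  set A := weightedGram V w with hA
  set B := weightedGram V (w + t • Pi.single i 1) with hB
  have hBA : B = A + replicateCol Unit (t • V i) * replicateRow Unit (V i) := by
    rw [hB, weightedGram_add, weightedGram_smul_single]
  have key : B⁻¹ = A⁻¹ - B⁻¹ * (replicateCol Unit (t • V i) * replicateRow Unit (V i)) * A⁻¹ := by
    rw [← sub_eq_iff_eq_add'.mpr hBA, Matrix.mul_sub, nonsing_inv_mul _ ht.isUnit,
      Matrix.sub_mul, Matrix.one_mul, Matrix.mul_assoc, mul_nonsing_inv _ hw.isUnit,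
      Matrix.mul_one, sub_sub_cancel]
  simp only [weightedKernel_apply, ← hA, ← hB]
  conv_lhs => rw [key]
  rw [sub_mulVec, dotProduct_sub]
  congr 1
  have hvec : replicateCol Unit (t • V i) * replicateRow Unit (V i) =
      vecMulVec (t • V i) (V i) := (vecMulVec_eq Unit _ _).symm
  rw [hvec, ← mulVec_mulVec, ← mulVec_mulVec, vecMulVec_mulVec, mulVec_smul, mulVec_smul]
  simp [dotProduct_smul, mul_left_comm, mul_comm]

section Differentiability

lemma Differentiable.matrix_det {E : Type*} [NormedAddCommGroup E] [NormedSpace ℝ E]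
    {A : E → Matrix n n ℝ} (hA : ∀ a b, Differentiable ℝ fun x => A x a b) :
    Differentiable ℝ fun x => (A x).det := by
  simp only [Matrix.det_apply]
  fun_prop

lemma Differentiable.matrix_adjugate {E : Type*} [NormedAddCommGroup E] [NormedSpace ℝ E]
    {A : E → Matrix n n ℝ} (hA : ∀ a b, Differentiable ℝ fun x => A x a b) (a b : n) :
    Differentiable ℝ fun x => (A x).adjugate a b := by
  simp only [Matrix.adjugate_apply]
  refine Differentiable.matrix_det fun c d => ?_
  by_cases h : c = b
  · subst h
    simp
  · simpa [Matrix.updateRow_apply, h] using hA c d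

lemma differentiable_det_weightedGram (V : Matrix m n ℝ) :
    Differentiable ℝ fun w => (weightedGram V w).det :=
  Differentiable.matrix_det (differentiable_weightedGram_apply V)

lemma differentiableAt_weightedKernel_apply {V : Matrix m n ℝ} {w : m → ℝ}
    (hw : (weightedGram V w).det ≠ 0) (i j : m) :
    DifferentiableAt ℝ (fun v => weightedKernel V v i j) w := by
  have hadj := fun a b =>
    Differentiable.matrix_adjugate (differentiable_weightedGram_apply V) a b w
  have hdet := (differentiable_det_weightedGram V w).inv hw
  simp only [weightedKernel, Matrix.mul_apply, Matrix.inv_def, Ring.inverse_eq_inv',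
    Matrix.smul_apply, smul_eq_mul]
  exact .fun_sum fun b _ => .mul_const (.fun_sum fun a _ =>
    .const_mul (hdet.mul (hadj a b)) _) _

end Differentiability

lemma fderiv_log_det_weightedGram {V : Matrix m n ℝ} {w : m → ℝ}
    (hw : (weightedGram V w).det ≠ 0) (i : m) :
    fderiv ℝ (fun v => Real.log (weightedGram V v).det) w (Pi.single i 1) =
      weightedKernel V w i i := by
  have hd := ((differentiable_det_weightedGram V w).log hw).hasFDerivAt.hasLineDerivAt
    (Pi.single i 1)
  refine hd.unique ?_
  have h : HasDerivAt (fun t : ℝ => (weightedGram V w).det * (1 + t * weightedKernel V w i i))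
      ((weightedGram V w).det * weightedKernel V w i i) 0 := by
    simpa using (((hasDerivAt_id (0 : ℝ)).mul_const (weightedKernel V w i i)).const_add 1).const_mul
      (weightedGram V w).det
  have hlog := h.log (by simpa using hw)
  simp only [HasLineDerivAt, det_weightedGram_add_smul_single hw]
  simpa [hw] using hlog

lemma fderiv_weightedKernel_apply {V : Matrix m n ℝ} {w : m → ℝ}
    (hw : (weightedGram V w).det ≠ 0) (i j k : m) :
    fderiv ℝ (fun v => weightedKernel V v j k) w (Pi.single i 1) =
      -(weightedKernel V w j i * weightedKernel V w i k) := by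
  have hline := fun a b => (differentiableAt_weightedKernel_apply hw a b).hasFDerivAt.hasLineDerivAt
    (Pi.single i 1)
  refine (hline j k).unique ?_
  have h := (((hasDerivAt_id (0 : ℝ)).mul
    ((hline j i).mul_const (weightedKernel V w i k))).const_sub (weightedKernel V w j k))
  have hne : ∀ᶠ t : ℝ in nhds 0, (weightedGram V (w + t • Pi.single i 1)).det ≠ 0 := by
    have hc : Continuous fun t : ℝ => (weightedGram V (w + t • Pi.single i 1)).det :=
      (differentiable_det_weightedGram V).continuous.comp (by fun_prop)
    exact hc.continuousAt.eventually_ne (by simpa using hw)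
  refine HasDerivAt.congr_of_eventuallyEq (by simpa using h) ?_
  filter_upwards [hne] with t ht
  simpa using weightedKernel_add_smul_single hw ht j k

end WeightedGram

theorem stmt_4 (M N : ℕ) (hN : 0 < N) (hMN : N ≤ M)
    (V : Matrix (Fin M) (Fin N) ℝ) (hV : V.rank = N)
    (G : (Fin M → ℝ) → Matrix (Fin N) (Fin N) ℝ)
    (hG : ∀ w, G w = Vᵀ * diagonal w * V)
    (E : (Fin M → ℝ) → ℝ)
    (hE : ∀ w, E w = -(1 / (N : ℝ)) * Real.log (G w).det + ∑ i, w i)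
    (w : Fin M → ℝ) (hw : (G w).PosDef) :
    DifferentiableAt ℝ E w ∧
    (∀ j, DifferentiableAt ℝ (fun v => fderiv ℝ E v (Pi.single j 1)) w) ∧
      ∀ i j, fderiv ℝ (fun v => fderiv ℝ E v (Pi.single j 1)) w (Pi.single i 1) =
        (1 / (N : ℝ)) * ((V * (G w)⁻¹ * Vᵀ) i j) ^ 2 := by
  obtain rfl : G = weightedGram V := funext hG
  obtain rfl : E = fun v => -(1 / (N : ℝ)) * Real.log (weightedGram V v).det + ∑ i, v i :=
    funext hE
  have hdet : (weightedGram V w).det ≠ 0 := hw.det_pos.ne'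
  have hlog : ∀ v, (weightedGram V v).det ≠ 0 →
      DifferentiableAt ℝ (fun v => Real.log (weightedGram V v).det) v :=
    fun v hv => (differentiable_det_weightedGram V v).log hv
  have hsum : ∀ v : Fin M → ℝ, HasFDerivAt (fun v : Fin M → ℝ => ∑ i, v i)
      (∑ i, ContinuousLinearMap.proj (R := ℝ) (φ := fun _ : Fin M => ℝ) i) v := fun v =>
    HasFDerivAt.fun_sum fun i _ => hasFDerivAt_apply i v
  have hgrad : ∀ j v, (weightedGram V v).det ≠ 0 →
      fderiv ℝ (fun v => -(1 / (N : ℝ)) * Real.log (weightedGram V v).det + ∑ i, v i) v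
        (Pi.single j 1) = -(1 / (N : ℝ)) * weightedKernel V v j j + 1 := by
    intro j v hv
    rw [(((hlog v hv).hasFDerivAt.const_mul _).fun_add (hsum v)).fderiv]
    simp [fderiv_log_det_weightedGram hv]
  have hev : ∀ j, (fun v => fderiv ℝ (fun v => -(1 / (N : ℝ)) *
      Real.log (weightedGram V v).det + ∑ i, v i) v (Pi.single j 1)) =ᶠ[nhds w]
      fun v => -(1 / (N : ℝ)) * weightedKernel V v j j + 1 := fun j => by
    filter_upwards [(differentiable_det_weightedGram V).continuous.continuousAt.eventually_ne hdet]
      with v hv using hgrad j v hv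
  have hK := fun j => differentiableAt_weightedKernel_apply hdet j j
  refine ⟨((hlog w hdet).const_mul _).add (hsum w).differentiableAt, fun j =>
    (((hK j).const_mul _).add_const _).congr_of_eventuallyEq (hev j), fun i j => ?_⟩
  rw [(hev j).fderiv_eq, (((hK j).hasFDerivAt.const_mul _).add_const _).fderiv,
    _root_.smul_apply, fderiv_weightedKernel_apply hdet,
    (weightedKernel_isSymm V w).apply, smul_eq_mul]
  change _ = 1 / (N : ℝ) * weightedKernel V w i j ^ 2
  ring
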